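/- Let n be a nonnegative integer and let a, b, c ∈ ℂ satisfy c + j ≠ 0 and 1−b+j ≠ 0 for 0 ≤ j ≤ n−1, 1−c−n+j ≠ 0 for 0 ≤ j ≤ ⌊n/2⌋, and b−n+j ≠ 0 for 0 ≤ j ≤ ⌊n/2⌋. Then ((c−a)_n (a−b)_n)/((c)_n (1−b)_n) = Σ_{k=0}^{⌊n/2⌋} C(n,2k) (b−k) (1−a)_k (a)_k (a−b−c+1)_k (b+c−a)_k / ((1−c−n)_k (b−n)_{k+1} (1−b)_k (c)_k) + Σ_{0 ≤ 2k+1 ≤ n} C(n,2k+1) (c+k) (1−a)_k (a)_{k+1} (a−b−c+1)_k (b+c−a)_{k+1} / ((1−c−n)_{k+1} (b−n)_{k+1} (1−b)_k (c)_{k+1}). (First-type reciprocal relation dual to the Pfaff–Saalschütz summation theorem.) -/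

import Mathlib

/-- Rising factorial (Pochhammer symbol) of a complex number:
`poch x 0 = 1` and `poch x (m+1) = poch x m * (x + m)`. -/
noncomputable def poch (x : ℂ) : ℕ → ℂ
  | 0 => 1
  | m + 1 => poch x m * (x + (m : ℂ))

theorem poch_s (x : ℂ) (m : ℕ) : poch x (m + 1) = poch x m * (x + (m : ℂ)) := rfl

theorem poch_z (x : ℂ) : poch x 0 = 1 := rfl

theorem poch_add (x : ℂ) (m l : ℕ) : poch x (m + l) = poch x m * poch (x + m) l := by
  induction l with
  | zero => simp [poch_z]
  | succ l ih =>
    rw [← add_assoc, poch_s, ih, poch_s]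
    push_cast
    ring

theorem poch_left (x : ℂ) (m : ℕ) : poch x (m + 1) = x * poch (x + 1) m := by
  rw [add_comm m 1, poch_add, poch_s, poch_z]
  push_cast
  ring

theorem poch_reflect (x : ℂ) (k m : ℕ) :
    poch (1 - x - ((m + k : ℕ) : ℂ)) k * poch x m = (-1) ^ k * poch x (m + k) := by
  induction k with
  | zero => simp [poch_z]
  | succ k ih =>
    rw [poch_left, ← add_assoc, poch_s x]
    have e : 1 - x - ((m + k + 1 : ℕ) : ℂ) + 1 = 1 - x - ((m + k : ℕ) : ℂ) := by
      push_cast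
      ring
    rw [e, mul_assoc, ih]
    push_cast
    ring

theorem poch_ne (x : ℂ) (n : ℕ) (h : ∀ j : ℕ, j < n → x + (j : ℂ) ≠ 0) : poch x n ≠ 0 := by
  induction n with
  | zero => simp [poch_z]
  | succ n ih =>
    rw [poch_s]
    exact mul_ne_zero (ih fun j hj => h j (by omega)) (h n (by omega))

/-- Newton-type basis. -/
noncomputable def newt (a s : ℂ) (j : ℕ) : ℂ :=
  poch (1 - a) (j / 2) * poch a ((j + 1) / 2) * poch (1 - s) (j / 2) * poch s ((j + 1) / 2)

noncomputable def dco (b c : ℂ) (n j : ℕ) : ℂ :=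
  poch (c + ((j / 2 : ℕ) : ℂ)) (n - j) * poch ((((j + 1) / 2 : ℕ) : ℂ) - b) (n - j)

noncomputable def eps (p : ℂ) (j : ℕ) : ℂ :=
  if j % 2 = 0 then ((j / 2 : ℕ) : ℂ) * (((j / 2 : ℕ) : ℂ) + p)
  else (((j / 2 : ℕ) : ℂ) + 1) * (((j / 2 : ℕ) : ℂ) + 1 - p)

theorem newt_succ (a s : ℂ) (j : ℕ) :
    newt a s (j + 1) = newt a s j * (a * s + eps (a + s) j) := by
  rcases Nat.even_or_odd' j with ⟨k, rfl | rfl⟩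
  · have h1 : (2 * k + 1) / 2 = k := by omega
    have h2 : (2 * k + 1 + 1) / 2 = k + 1 := by omega
    have h3 : (2 * k) / 2 = k := by omega
    have h4 : (2 * k) % 2 = 0 := by omega
    simp only [newt, eps, h1, h2, h3, h4, poch_s, if_true]
    ring
  · have h1 : (2 * k + 1) / 2 = k := by omega
    have h2 : (2 * k + 1 + 1) / 2 = k + 1 := by omega
    have h3 : (2 * k + 1 + 1 + 1) / 2 = k + 1 := by omega
    have h4 : ¬ (2 * k + 1) % 2 = 0 := by omega
    simp only [newt, eps, h1, h2, h3, h4, poch_s, if_false]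
    ring

theorem choose_c (n j : ℕ) (h : j ≤ n) :
    (n.choose (j + 1) : ℂ) * ((j : ℂ) + 1) = (n.choose j : ℂ) * ((n : ℂ) - j) := by
  have := Nat.choose_succ_right_eq n j
  have h2 : ((n.choose (j + 1) * (j + 1) : ℕ) : ℂ) = ((n.choose j * (n - j) : ℕ) : ℂ) := by
    rw [this]
  push_cast [Nat.cast_sub h] at h2
  exact h2

theorem dco_zero (b c : ℂ) (n : ℕ) :
    dco b c (n + 1) 0 = dco b c n 0 * ((c + n) * (n - b) - eps (b + c) 0) := by
  simp [dco, eps, poch_s]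
  ring

theorem dco_rec (b c : ℂ) (n j : ℕ) (hj : j ≤ n) :
    ((n + 1).choose (j + 1) : ℂ) * dco b c (n + 1) (j + 1) =
      (n.choose j : ℂ) * dco b c n j +
      (n.choose (j + 1) : ℂ) * dco b c n (j + 1) * ((c + n) * (n - b) - eps (b + c) (j + 1)) := by
  have hch := choose_c n j hj
  have hp : ((n + 1).choose (j + 1) : ℂ) = n.choose j + n.choose (j + 1) := by
    rw [Nat.choose_succ_succ]; push_cast; rfl
  rcases hj.eq_or_lt with rfl | hlt
  · simp [dco, poch_z]
  obtain ⟨m, rfl⟩ : ∃ m, n = j + 1 + m := ⟨n - (j + 1), by omega⟩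
  rw [hp]
  have s1 : j + 1 + m + 1 - (j + 1) = m + 1 := by omega
  have s2 : j + 1 + m - j = m + 1 := by omega
  have s3 : j + 1 + m - (j + 1) = m := by omega
  simp only [dco, s1, s2, s3]
  generalize ((j + 1 + m).choose j : ℂ) = X at *
  generalize ((j + 1 + m).choose (j + 1) : ℂ) = Y at *
  rcases Nat.even_or_odd' j with ⟨k, rfl | rfl⟩
  · have h1 : (2 * k + 1) / 2 = k := by omega
    have h2 : (2 * k + 1 + 1) / 2 = k + 1 := by omega
    have h3 : (2 * k) / 2 = k := by omega
    have h4 : ¬ (2 * k + 1) % 2 = 0 := by omega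
    simp only [eps, h1, h2, h3, h4, if_false]
    rw [poch_left ((k : ℂ) - b), poch_s (c + k), poch_s (((k + 1 : ℕ) : ℂ) - b)]
    have e : (k : ℂ) - b + 1 = ((k + 1 : ℕ) : ℂ) - b := by push_cast; ring
    rw [e]
    generalize poch (((k + 1 : ℕ) : ℂ) - b) m = P
    generalize poch (c + k) m = Q
    push_cast at *
    linear_combination (-P * Q * (c + k + m)) * hch
  · have h1 : (2 * k + 1) / 2 = k := by omega
    have h2 : (2 * k + 1 + 1) / 2 = k + 1 := by omega
    have h3 : (2 * k + 1 + 1 + 1) / 2 = k + 1 := by omega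
    have h4 : (2 * k + 1 + 1) % 2 = 0 := by omega
    simp only [eps, h1, h2, h3, h4, if_true]
    rw [poch_left (c + k), poch_s (c + ((k + 1 : ℕ) : ℂ)), poch_s (((k + 1 : ℕ) : ℂ) - b)]
    have e : c + (k : ℂ) + 1 = c + ((k + 1 : ℕ) : ℂ) := by push_cast; ring
    rw [e]
    generalize poch (((k + 1 : ℕ) : ℂ) - b) m = P
    generalize poch (c + ((k + 1 : ℕ) : ℂ)) m = Q
    push_cast at *
    linear_combination (-P * Q * (k + 1 - b + m)) * hch

theorem main_poly (a b c : ℂ) (n : ℕ) :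
    poch (c - a) n * poch (a - b) n =
      ∑ j ∈ Finset.range (n + 1), (n.choose j : ℂ) * dco b c n j * newt a (b + c - a) j := by
  induction n with
  | zero => simp [poch_z, dco, newt]
  | succ n ih =>
    have e : poch (c - a) (n + 1) * poch (a - b) (n + 1) =
        (poch (c - a) n * poch (a - b) n) * (a * (b + c - a) + (c + n) * (n - b)) := by
      rw [poch_s, poch_s]; ring
    have hN : ∀ j, newt a (b + c - a) (j + 1) =
        newt a (b + c - a) j * (a * (b + c - a) + eps (b + c) j) := by
      intro j
      rw [newt_succ]
      congr 3
      ring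
    rw [e, ih, Finset.sum_mul, Finset.sum_range_succ' _ (n + 1)]
    have h1 : ∀ j ∈ Finset.range (n + 1),
        ((n + 1).choose (j + 1) : ℂ) * dco b c (n + 1) (j + 1) * newt a (b + c - a) (j + 1) =
        (n.choose j : ℂ) * dco b c n j * newt a (b + c - a) (j + 1) +
        (n.choose (j + 1) : ℂ) * dco b c n (j + 1) *
          ((c + n) * (n - b) - eps (b + c) (j + 1)) * newt a (b + c - a) (j + 1) := by
      intro j hj
      rw [dco_rec b c n j (by simpa [Nat.lt_succ_iff] using hj)]
      ring
    rw [Finset.sum_congr rfl h1, Finset.sum_add_distrib, add_assoc]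
    have h2 := Finset.sum_range_succ' (fun j => (n.choose j : ℂ) * dco b c n j *
          ((c + n) * (n - b) - eps (b + c) j) * newt a (b + c - a) j) (n + 1)
    have h3 : ((n + 1).choose 0 : ℂ) * dco b c (n + 1) 0 * newt a (b + c - a) 0 =
        (n.choose 0 : ℂ) * dco b c n 0 *
          ((c + n) * (n - b) - eps (b + c) 0) * newt a (b + c - a) 0 := by
      rw [dco_zero]; simp
    rw [h3, ← h2, Finset.sum_range_succ _ (n + 1), Nat.choose_succ_self]
    simp only [Nat.cast_zero, zero_mul, add_zero]
    rw [← Finset.sum_add_distrib]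
    refine Finset.sum_congr rfl fun j _ => ?_
    rw [hN]
    ring

theorem sum_split (F : ℕ → ℂ) (m : ℕ) :
    ∑ j ∈ Finset.range m, F j = ∑ k ∈ Finset.range ((m + 1) / 2), F (2 * k) +
      ∑ k ∈ Finset.range (m / 2), F (2 * k + 1) := by
  induction m with
  | zero => simp
  | succ m ih =>
    rw [Finset.sum_range_succ, ih]
    rcases Nat.even_or_odd' m with ⟨k, rfl | rfl⟩
    · have h1 : (2 * k + 1) / 2 = k := by omega
      have h2 : (2 * k + 1 + 1) / 2 = k + 1 := by omega
      have h3 : (2 * k) / 2 = k := by omega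
      rw [h1, h2, h3, Finset.sum_range_succ]
      ring
    · have h1 : (2 * k + 1) / 2 = k := by omega
      have h2 : (2 * k + 1 + 1) / 2 = k + 1 := by omega
      have h3 : (2 * k + 1 + 1 + 1) / 2 = k + 1 := by omega
      rw [h1, h2, h3, Finset.sum_range_succ (fun k => F (2 * k + 1)) k]
      ring

theorem even_id (b c : ℂ) (n k : ℕ) (hk : 2 * k ≤ n) (hn : 1 ≤ n) :
    (b - k) * (poch c n * poch (1 - b) n) = dco b c n (2 * k) *
      (poch (1 - c - (n : ℂ)) k * poch (b - (n : ℂ)) (k + 1) * poch (1 - b) k * poch c k) := by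
  obtain ⟨m, rfl⟩ : ∃ m, n = 2 * k + m := ⟨n - 2 * k, by omega⟩
  have h1 : (2 * k + 1) / 2 = k := by omega
  have h3 : (2 * k) / 2 = k := by omega
  have s : 2 * k + m - 2 * k = m := by omega
  simp only [dco, h1, h3, s]
  have r1 := poch_reflect c k (k + m)
  rw [show k + m + k = 2 * k + m by ring, poch_add c k m] at r1
  obtain ⟨q, hq⟩ : ∃ q, k + m = q + 1 := ⟨k + m - 1, by omega⟩
  have r2 := poch_reflect (1 - b) (k + 1) q
  rw [show q + (k + 1) = 2 * k + m by omega, show 1 - (1 - b) - ((2 * k + m : ℕ) : ℂ) =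
    b - ((2 * k + m : ℕ) : ℂ) by ring] at r2
  have r3 : poch (1 - b) k * poch (k - b) m = (k - b) * poch (1 - b) q := by
    rcases m with _ | m
    · obtain rfl : k = q + 1 := by omega
      rw [poch_s, poch_z]
      push_cast
      ring
    · obtain rfl : q = k + m := by omega
      rw [poch_left, poch_add, show (k : ℂ) - b + 1 = 1 - b + k by ring]
      ring
  have hs : ((-1 : ℂ) ^ k) * (-1) ^ k = 1 := by rw [← mul_pow]; simp
  generalize poch (1 - c - ((2 * k + m : ℕ) : ℂ)) k = A at *
  generalize poch (b - ((2 * k + m : ℕ) : ℂ)) (k + 1) = B at *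
  generalize poch c (2 * k + m) = C at *
  generalize poch (1 - b) (2 * k + m) = D at *
  rw [pow_succ] at r2
  calc (b - k) * (C * D) = (k - b) * (((-1 : ℂ) ^ k * C) * ((-1) ^ k * -1 * D)) := by
        linear_combination (-(k - b) * C * D) * (-hs)
    _ = A * (poch c k * poch (c + k) m) * (B * ((k - b) * poch (1 - b) q)) := by
        rw [← r1, ← r2]; ring
    _ = _ := by rw [← r3]; ring

theorem odd_id (b c : ℂ) (n k : ℕ) (hk : 2 * k + 1 ≤ n) :
    (c + k) * (poch c n * poch (1 - b) n) = dco b c n (2 * k + 1) *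
      (poch (1 - c - (n : ℂ)) (k + 1) * poch (b - (n : ℂ)) (k + 1) * poch (1 - b) k *
        poch c (k + 1)) := by
  obtain ⟨m, rfl⟩ : ∃ m, n = 2 * k + 1 + m := ⟨n - (2 * k + 1), by omega⟩
  have h1 : (2 * k + 1) / 2 = k := by omega
  have h2 : (2 * k + 1 + 1) / 2 = k + 1 := by omega
  have s : 2 * k + 1 + m - (2 * k + 1) = m := by omega
  simp only [dco, h1, h2, s]
  have r1 := poch_reflect c (k + 1) (k + m)
  rw [show k + m + (k + 1) = 2 * k + 1 + m by ring, poch_add c k m] at r1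
  have r2 := poch_reflect (1 - b) (k + 1) (k + m)
  rw [show k + m + (k + 1) = 2 * k + 1 + m by ring, poch_add (1 - b) k m,
    show 1 - (1 - b) - ((2 * k + 1 + m : ℕ) : ℂ) = b - ((2 * k + 1 + m : ℕ) : ℂ) by ring] at r2
  have hs : ((-1 : ℂ) ^ (k + 1)) * (-1) ^ (k + 1) = 1 := by rw [← mul_pow]; simp
  rw [poch_s c k, show ((k + 1 : ℕ) : ℂ) - b = 1 - b + k by push_cast; ring]
  generalize poch (1 - c - ((2 * k + 1 + m : ℕ) : ℂ)) (k + 1) = A at *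
  generalize poch (b - ((2 * k + 1 + m : ℕ) : ℂ)) (k + 1) = B at *
  generalize poch c (2 * k + 1 + m) = C at *
  generalize poch (1 - b) (2 * k + 1 + m) = D at *
  calc (c + k) * (C * D) = (c + k) * (((-1 : ℂ) ^ (k + 1) * C) * ((-1) ^ (k + 1) * D)) := by
        linear_combination (-(c + k) * C * D) * hs
    _ = _ := by rw [← r1, ← r2]; ring

/-- First-type reciprocal relation dual to the Pfaff–Saalschütz summation theorem. -/
theorem ps_reciprocal_first (n : ℕ) (a b c : ℂ)
    (hc : ∀ j : ℕ, j < n → c + (j : ℂ) ≠ 0)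
    (hb : ∀ j : ℕ, j < n → 1 - b + (j : ℂ) ≠ 0)
    (hcn : ∀ j : ℕ, j ≤ n / 2 → 1 - c - (n : ℂ) + (j : ℂ) ≠ 0)
    (hbn : ∀ j : ℕ, j ≤ n / 2 → b - (n : ℂ) + (j : ℂ) ≠ 0) :
    poch (c - a) n * poch (a - b) n / (poch c n * poch (1 - b) n) =
      (∑ k ∈ Finset.range (n / 2 + 1),
        (n.choose (2 * k) : ℂ) *
          ((b - (k : ℂ)) * poch (1 - a) k * poch a k * poch (a - b - c + 1) k *
            poch (b + c - a) k) /
          (poch (1 - c - (n : ℂ)) k * poch (b - (n : ℂ)) (k + 1) * poch (1 - b) k *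
            poch c k)) +
      ∑ k ∈ Finset.range ((n + 1) / 2),
        (n.choose (2 * k + 1) : ℂ) *
          ((c + (k : ℂ)) * poch (1 - a) k * poch a (k + 1) * poch (a - b - c + 1) k *
            poch (b + c - a) (k + 1)) /
          (poch (1 - c - (n : ℂ)) (k + 1) * poch (b - (n : ℂ)) (k + 1) * poch (1 - b) k *
            poch c (k + 1)) := by
  rcases Nat.eq_zero_or_pos n with rfl | hn
  · have := hbn 0 (by simp)
    simp only [Nat.cast_zero, sub_zero, add_zero] at this
    simp [poch_z, poch_s, this]
  have hC := poch_ne c n hc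
  have hB := poch_ne (1 - b) n hb
  have hP : poch c n * poch (1 - b) n ≠ 0 := mul_ne_zero hC hB
  have zC : ∀ k, k ≤ n → poch c k ≠ 0 := fun k hk => poch_ne _ _ fun j hj => hc j (by omega)
  have zB : ∀ k, k ≤ n → poch (1 - b) k ≠ 0 := fun k hk => poch_ne _ _ fun j hj => hb j (by omega)
  have zC' : ∀ k, k ≤ n / 2 + 1 → poch (1 - c - (n : ℂ)) k ≠ 0 :=
    fun k hk => poch_ne _ _ fun j hj => hcn j (by omega)
  have zB' : ∀ k, k ≤ n / 2 + 1 → poch (b - (n : ℂ)) k ≠ 0 :=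
    fun k hk => poch_ne _ _ fun j hj => hbn j (by omega)
  rw [main_poly, sum_split, add_div, Finset.sum_div, Finset.sum_div,
    show (n + 1 + 1) / 2 = n / 2 + 1 by omega]
  have e1 : a - b - c + 1 = 1 - (b + c - a) := by ring
  rw [e1]
  congr 1
  · refine Finset.sum_congr rfl fun k hk => ?_
    have hk' : k ≤ n / 2 := by simpa [Nat.lt_succ_iff] using hk
    have h1 : (2 * k + 1) / 2 = k := by omega
    have h3 : (2 * k) / 2 = k := by omega
    rw [div_eq_div_iff hP (mul_ne_zero (mul_ne_zero (mul_ne_zero (zC' k (by omega))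
      (zB' (k + 1) (by omega))) (zB k (by omega))) (zC k (by omega)))]
    simp only [newt, h1, h3]
    linear_combination (-(n.choose (2 * k) : ℂ) * (poch (1 - a) k * poch a k *
      poch (1 - (b + c - a)) k * poch (b + c - a) k)) * even_id b c n k (by omega) hn
  · refine Finset.sum_congr rfl fun k hk => ?_
    have hk' : k < (n + 1) / 2 := by simpa using hk
    have h1 : (2 * k + 1) / 2 = k := by omega
    have h2 : (2 * k + 1 + 1) / 2 = k + 1 := by omega
    rw [div_eq_div_iff hP (mul_ne_zero (mul_ne_zero (mul_ne_zero (zC' (k + 1) (by omega))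
      (zB' (k + 1) (by omega))) (zB k (by omega))) (zC (k + 1) (by omega)))]
    simp only [newt, h1, h2]
    linear_combination (-(n.choose (2 * k + 1) : ℂ) * (poch (1 - a) k * poch a (k + 1) *
      poch (1 - (b + c - a)) k * poch (b + c - a) (k + 1))) * odd_id b c n k (by omega)
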